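/- For every graph G, tw(G) + 1 equals the bramble number bn(G), i.e., the maximum over brambles B in G of the minimum size of a hitting set of B. -/

import Mathlib

open SimpleGraph

/-- A tree-decomposition of `G` with tree `T` and bags `B`: every vertex is in some bag,
every edge lies in a bag, and the bags containing a given vertex induce a nonempty
connected subtree of `T`. -/
def IsTreeDecomp {V ι : Type} (G : SimpleGraph V) (T : SimpleGraph ι) (B : ι → Set V) : Prop :=
  T.IsTree ∧
  (∀ v : V, ∃ x, v ∈ B x) ∧
  (∀ ⦃v w : V⦄, G.Adj v w → ∃ x, v ∈ B x ∧ w ∈ B x) ∧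
  (∀ v : V, (T.induce {x | v ∈ B x}).Connected)

/-- `G` has a tree-decomposition of width at most `k`. -/
def HasTreeDecompOfWidth {V : Type} (G : SimpleGraph V) (k : ℕ) : Prop :=
  ∃ (ι : Type) (T : SimpleGraph ι) (B : ι → Set V),
    IsTreeDecomp G T B ∧ ∀ x, (B x).ncard ≤ k + 1

/-- The treewidth of a graph: the minimum width of a tree-decomposition. -/
noncomputable def treewidth {V : Type} (G : SimpleGraph V) : ℕ :=
  sInf {k | HasTreeDecompOfWidth G k}

/-- A bramble: a set of nonempty connected vertex sets that pairwise touch. -/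
def IsBramble {V : Type} (G : SimpleGraph V) (𝔅 : Set (Set V)) : Prop :=
  ∀ A ∈ 𝔅, A.Nonempty ∧ (G.induce A).Connected ∧
    ∀ B ∈ 𝔅, (A ∩ B).Nonempty ∨ ∃ a ∈ A, ∃ b ∈ B, G.Adj a b

/-- The order of a bramble: the minimum size of a hitting set. -/
noncomputable def brambleOrder {V : Type} (G : SimpleGraph V) (𝔅 : Set (Set V)) : ℕ :=
  sInf {n | ∃ S : Set V, (∀ A ∈ 𝔅, (S ∩ A).Nonempty) ∧ S.ncard = n}

/-- The bramble number: the maximum order of a bramble. -/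
noncomputable def brambleNumber {V : Type} (G : SimpleGraph V) : ℕ :=
  sSup {n | ∃ 𝔅 : Set (Set V), IsBramble G 𝔅 ∧ brambleOrder G 𝔅 = n}

/-- Every walk of `T` from `s` to `u` passes through `t`. -/
def SimpleGraph.OnAllWalks {ι : Type} (T : SimpleGraph ι) (s t u : ι) : Prop :=
  ∀ p : T.Walk s u, t ∈ p.support

namespace SimpleGraph

variable {V ι κ : Type} {G : SimpleGraph V} {T : SimpleGraph ι}

lemma exists_adj_crossing {A S : Set V} (hA : (G.induce A).Preconnected) {a b : V}
    (ha : a ∈ A) (haS : a ∈ S) (hb : b ∈ A) (hbS : b ∉ S) :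
    ∃ a' ∈ A, a' ∈ S ∧ ∃ b' ∈ A, b' ∉ S ∧ G.Adj a' b' := by
  obtain ⟨p⟩ := hA ⟨a, ha⟩ ⟨b, hb⟩
  obtain ⟨d, -, h1, h2⟩ := p.exists_boundary_dart (Subtype.val ⁻¹' S) haS hbS
  exact ⟨d.fst, d.fst.2, h1, d.snd, d.snd.2, h2, d.adj⟩

lemma exists_walk_support_subset {A : Set V} (hA : (G.induce A).Preconnected) {a b : V}
    (ha : a ∈ A) (hb : b ∈ A) : ∃ p : G.Walk a b, ∀ x ∈ p.support, x ∈ A := by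
  obtain ⟨p⟩ := hA ⟨a, ha⟩ ⟨b, hb⟩
  refine ⟨p.map (Embedding.induce A).toHom, fun x hx ↦ ?_⟩
  obtain ⟨y, -, rfl⟩ := List.mem_map.1
    ((congrArg (x ∈ ·) (Walk.support_map (Embedding.induce A).toHom p)).mp hx)
  exact y.2

lemma IsAcyclic.onAllWalks_of_mem_support (hT : T.IsAcyclic) {s t u : ι} {p : T.Walk s u}
    (hp : p.IsPath) (ht : t ∈ p.support) : T.OnAllWalks s t u := by
  classical
  intro q
  have h := congrArg Subtype.val ((hT.subsingleton_path s u).elim ⟨p, hp⟩ ⟨q.bypass, q.bypass_isPath⟩)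
  exact q.support_bypass_subset_support (by rw [← show p = q.bypass from h]; exact ht)

lemma Walk.exists_first_mem {P : Set ι} {z w : ι} (q : T.Walk z w) (hw : w ∈ P) :
    ∃ m ∈ P, ∃ r : T.Walk z m, ∀ x ∈ r.support, x ∈ P → x = m := by
  induction q with
  | nil => exact ⟨_, hw, .nil, by simp⟩
  | @cons a b c hab q ih =>
    by_cases ha : a ∈ P
    · exact ⟨a, ha, .nil, by simp⟩
    · obtain ⟨m, hm, r, hr⟩ := ih hw
      refine ⟨m, hm, .cons hab r, fun x hx hxP ↦ ?_⟩
      rw [Walk.support_cons, List.mem_cons] at hx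
      rcases hx with rfl | hx
      · exact absurd hxP ha
      · exact hr x hx hxP

lemma Walk.IsPath.append_of_disjoint {x m z : ι} {p : T.Walk x m} {q : T.Walk m z}
    (hp : p.IsPath) (hq : q.IsPath) (h : ∀ t ∈ p.support, t ∈ q.support → t = m) :
    (p.append q).IsPath := by
  rw [Walk.isPath_def, Walk.support_append, List.nodup_append']
  have hq' := hq.support_nodup
  rw [← Walk.cons_tail_support, List.nodup_cons] at hq'
  refine ⟨hp.support_nodup, hq'.2, fun t htp htq ↦ ?_⟩
  obtain rfl := h t htp (List.mem_of_mem_tail htq)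
  exact hq'.1 htq

/-- Any three vertices of a tree have a median. -/
lemma IsTree.exists_median (hT : T.IsTree) (x y z : ι) :
    ∃ m, T.OnAllWalks x m y ∧ T.OnAllWalks x m z ∧ T.OnAllWalks y m z := by
  classical
  obtain ⟨p, hp⟩ := (hT.existsUnique_path x y).exists
  obtain ⟨q⟩ := hT.1.preconnected z x
  obtain ⟨m, hm, r, hr⟩ := q.exists_first_mem (P := {t | t ∈ p.support}) p.start_mem_support
  have hr' : ∀ t ∈ r.bypass.reverse.support, t ∈ p.support → t = m := fun t ht htp ↦
    hr t (r.support_bypass_subset_support (by simpa using ht)) htp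
  have hrp := r.bypass_isPath.reverse
  refine ⟨m, hT.2.onAllWalks_of_mem_support hp hm,
    hT.2.onAllWalks_of_mem_support
      ((hp.takeUntil hm).append_of_disjoint hrp fun t ht ht' ↦
        hr' t ht' (p.support_takeUntil_subset_support hm ht)) ?_,
    hT.2.onAllWalks_of_mem_support
      ((hp.dropUntil hm).reverse.append_of_disjoint hrp fun t ht ht' ↦
        hr' t ht' (p.support_dropUntil_subset_support hm (by simpa using ht))) ?_⟩
  all_goals
    rw [Walk.mem_support_append_iff]
    exact .inl (Walk.end_mem_support _)

/-- A set of vertices closed under taking the vertices that separate two of its members. -/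
def WalkConvex (T : SimpleGraph ι) (S : Set ι) : Prop :=
  ∀ ⦃x y z⦄, x ∈ S → y ∈ S → T.OnAllWalks x z y → z ∈ S

lemma WalkConvex.inter {S S' : Set ι} (h : T.WalkConvex S) (h' : T.WalkConvex S') :
    T.WalkConvex (S ∩ S') :=
  fun _ _ _ hx hy hz ↦ ⟨h hx.1 hy.1 hz, h' hx.2 hy.2 hz⟩

/-- The Helly property of subtrees. -/
lemma IsTree.helly (hT : T.IsTree) (s : Finset κ) (f : κ → Set ι)
    (hf : ∀ i ∈ s, T.WalkConvex (f i)) (hs : ∀ i ∈ s, ∀ j ∈ s, (f i ∩ f j).Nonempty) :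
    ∃ m, ∀ i ∈ s, m ∈ f i := by
  classical
  induction s using Finset.induction_on generalizing f with
  | empty =>
    obtain ⟨m⟩ := hT.1.nonempty
    exact ⟨m, by simp⟩
  | insert a s ha ih =>
    have haS := Finset.mem_insert_self a s
    have hsub {i} (hi : i ∈ s) : i ∈ insert a s := Finset.mem_insert_of_mem hi
    obtain ⟨m, hm⟩ := ih (fun i ↦ f a ∩ f i)
      (fun i hi ↦ (hf a haS).inter (hf i (hsub hi))) (by
        intro i hi j hj
        obtain ⟨x, hxa, hxi⟩ := hs a haS i (hsub hi)
        obtain ⟨y, hya, hyj⟩ := hs a haS j (hsub hj)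
        obtain ⟨z, hzi, hzj⟩ := hs i (hsub hi) j (hsub hj)
        obtain ⟨m, h1, h2, h3⟩ := hT.exists_median x y z
        have hma := hf a haS hxa hya h1
        exact ⟨m, ⟨hma, hf i (hsub hi) hxi hzi h2⟩, hma, hf j (hsub hj) hyj hzj h3⟩)
    rcases s.eq_empty_or_nonempty with rfl | ⟨i, hi⟩
    · obtain ⟨m, hm, -⟩ := hs a haS a haS
      exact ⟨m, by simpa using hm⟩
    · refine ⟨m, fun j hj ↦ ?_⟩
      rcases Finset.mem_insert.1 hj with rfl | hj
      · exact (hm i hi).1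
      · exact (hm j hj).2

lemma IsAcyclic.sum {T' : SimpleGraph κ} (hT : T.IsAcyclic) (hT' : T'.IsAcyclic) :
    (T ⊕g T').IsAcyclic := by
  rw [isAcyclic_iff_forall_adj_isBridge] at hT hT' ⊢
  rintro (v | v) (w | w) h
  · intro ⟨p⟩
    refine hT (sum_adj_inl.1 h) ?_
    by_contra hn
    obtain ⟨⟨⟨a, b⟩, hab⟩, -, h1, h2⟩ := p.exists_boundary_dart
      {x | ∃ a, x = .inl a ∧ (T.deleteEdges {s(v, w)}).Reachable v a}
      ⟨v, rfl, .rfl⟩ (by simpa using hn)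
    obtain ⟨a', rfl, ha'⟩ := h1
    rcases b with b | b
    · exact h2 ⟨b, rfl, ha'.trans (Adj.reachable (by simpa using hab))⟩
    · simp at hab
  · simp at h
  · simp at h
  · intro ⟨p⟩
    refine hT' (sum_adj_inr.1 h) ?_
    by_contra hn
    obtain ⟨⟨⟨a, b⟩, hab⟩, -, h1, h2⟩ := p.exists_boundary_dart
      {x | ∃ a, x = .inr a ∧ (T'.deleteEdges {s(v, w)}).Reachable v a}
      ⟨v, rfl, .rfl⟩ (by simpa using hn)
    obtain ⟨a', rfl, ha'⟩ := h1
    rcases b with b | b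
    · simp at hab
    · exact h2 ⟨b, rfl, ha'.trans (Adj.reachable (by simpa using hab))⟩

lemma IsTree.sum_sup_edge {T' : SimpleGraph κ} (hT : T.IsTree) (hT' : T'.IsTree) (s : ι) (t : κ) :
    ((T ⊕g T') ⊔ edge (.inl s) (.inr t)).IsTree :=
  ⟨hT.1.sum_sup_edge hT'.1,
    (hT.2.sum hT'.2).sup_edge_of_not_reachable (not_reachable_sum_inl_inr s t)⟩

end SimpleGraph

section TreeDecomp

variable {V ι : Type} {G : SimpleGraph V} {T : SimpleGraph ι} {B : ι → Set V}

lemma IsTreeDecomp.exists_walk_notMem (h : IsTreeDecomp G T B) {v : V} {x y z : ι}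
    (hx : v ∈ B x) (hy : v ∈ B y) (hz : v ∉ B z) : ∃ p : T.Walk x y, z ∉ p.support := by
  obtain ⟨p, hp⟩ := exists_walk_support_subset (h.2.2.2 v).preconnected
    (a := x) (b := y) hx hy
  exact ⟨p, fun hzp ↦ hz (hp z hzp)⟩

/-- The nodes whose bags meet a connected set form a convex set of nodes. -/
lemma IsTreeDecomp.walkConvex (h : IsTreeDecomp G T B) {A : Set V}
    (hA : (G.induce A).Preconnected) : T.WalkConvex {t | (B t ∩ A).Nonempty} := by
  rintro x y z ⟨a, hax, haA⟩ ⟨b, hby, hbA⟩ hz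
  by_contra hzA
  have hzA' {v : V} (hv : v ∈ A) : v ∉ B z := fun hvz ↦ hzA ⟨v, hvz, hv⟩
  by_cases hb : ∃ t, b ∈ B t ∧ ∃ p : T.Walk x t, z ∉ p.support
  · obtain ⟨t, hbt, p, hp⟩ := hb
    obtain ⟨q, hq⟩ := h.exists_walk_notMem hbt hby (hzA' hbA)
    have := hz (p.append q)
    rw [Walk.mem_support_append_iff] at this
    exact this.elim hp hq
  · have ha : ∃ t, a ∈ B t ∧ ∃ p : T.Walk x t, z ∉ p.support :=
      ⟨x, hax, h.exists_walk_notMem hax hax (hzA' haA)⟩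
    obtain ⟨a', ha'A, ⟨t, hat, p, hp⟩, b', hb'A, hb', hadj⟩ := exists_adj_crossing
      (S := {v | ∃ t, v ∈ B t ∧ ∃ p : T.Walk x t, z ∉ p.support}) hA haA ha hbA hb
    obtain ⟨u, hau, hbu⟩ := h.2.2.1 hadj
    obtain ⟨q, hq⟩ := h.exists_walk_notMem hat hau (hzA' ha'A)
    refine hb' ⟨u, hbu, p.append q, ?_⟩
    rw [Walk.mem_support_append_iff]
    exact fun h ↦ h.elim hp hq

/-- Some bag of a tree-decomposition hits a given bramble. -/
lemma IsTreeDecomp.exists_bag_hitting [Finite V] (h : IsTreeDecomp G T B) {𝔅 : Set (Set V)}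
    (h𝔅 : IsBramble G 𝔅) : ∃ t, ∀ A ∈ 𝔅, (B t ∩ A).Nonempty := by
  obtain ⟨m, hm⟩ := h.1.helly (𝔅.toFinite.toFinset) (fun A ↦ {t | (B t ∩ A).Nonempty})
    (fun A hA ↦ h.walkConvex (h𝔅 A (by simpa using hA)).2.1.preconnected) (by
      intro A hA A' hA'
      rw [Set.Finite.mem_toFinset] at hA hA'
      rcases (h𝔅 A hA).2.2 A' hA' with ⟨v, hv, hv'⟩ | ⟨a, ha, b, hb, hab⟩
      · obtain ⟨t, ht⟩ := h.2.1 v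
        exact ⟨t, ⟨v, ht, hv⟩, v, ht, hv'⟩
      · obtain ⟨t, hat, hbt⟩ := h.2.2.1 hab
        exact ⟨t, ⟨a, hat, ha⟩, b, hbt, hb⟩)
  exact ⟨m, fun A hA ↦ hm A (by simpa using hA)⟩

/-- The vertices in bags that `t` separates from the root `s`, including the bag of `t`. -/
def farSide (T : SimpleGraph ι) (B : ι → Set V) (s t : ι) : Set V :=
  {v | ∃ u, v ∈ B u ∧ T.OnAllWalks s t u}

/-- The vertices in bags that `t` does not separate from the root `s`, and the bag of `t`. -/
def nearSide (T : SimpleGraph ι) (B : ι → Set V) (s t : ι) : Set V :=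
  {v | v ∈ B t ∨ ∃ u, v ∈ B u ∧ ¬ T.OnAllWalks s t u}

lemma bag_subset_farSide (s t : ι) : B t ⊆ farSide T B s t :=
  fun _ hv ↦ ⟨t, hv, fun p ↦ p.end_mem_support⟩

lemma root_bag_subset_nearSide (s t : ι) : B s ⊆ nearSide T B s t := by
  intro v hv
  by_cases h : s = t
  · subst h
    exact .inl hv
  · exact .inr ⟨s, hv, fun hs ↦ h (by simpa using hs .nil : t = s).symm⟩

lemma IsTreeDecomp.mem_bag_of_mem_nearSide_of_mem_farSide (h : IsTreeDecomp G T B) {s t : ι}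
    {v : V} (hn : v ∈ nearSide T B s t) (hf : v ∈ farSide T B s t) : v ∈ B t := by
  rcases hn with hn | ⟨u, hu, hsu⟩
  · exact hn
  obtain ⟨w, hw, hsw⟩ := hf
  by_contra hv
  obtain ⟨p, hp⟩ := not_forall.1 hsu
  obtain ⟨q, hq⟩ := h.exists_walk_notMem hu hw hv
  have := hsw (p.append q)
  rw [Walk.mem_support_append_iff] at this
  exact this.elim hp hq

lemma IsTreeDecomp.mem_farSide_of_adj (h : IsTreeDecomp G T B) {s t : ι} {v w : V}
    (hadj : G.Adj v w) (hw : w ∉ nearSide T B s t) : v ∈ farSide T B s t := by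
  obtain ⟨u, hvu, hwu⟩ := h.2.2.1 hadj
  by_cases hs : T.OnAllWalks s t u
  · exact ⟨u, hvu, hs⟩
  · exact absurd (.inr ⟨u, hwu, hs⟩) hw

/-- A tree-decomposition of the subgraph of `G` induced on `S`. -/
structure IsTreeDecompOn (G : SimpleGraph V) (S : Set V) (T : SimpleGraph ι) (B : ι → Set V) :
    Prop where
  isTree : T.IsTree
  subset : ∀ t, B t ⊆ S
  exists_mem : ∀ v ∈ S, ∃ t, v ∈ B t
  exists_edge : ∀ v ∈ S, ∀ w ∈ S, G.Adj v w → ∃ t, v ∈ B t ∧ w ∈ B t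
  connected : ∀ v ∈ S, (T.induce {t | v ∈ B t}).Connected

lemma IsTreeDecompOn.isTreeDecomp (h : IsTreeDecompOn G Set.univ T B) : IsTreeDecomp G T B :=
  ⟨h.isTree, fun v ↦ h.exists_mem v trivial, fun v w ↦ h.exists_edge v trivial w trivial,
    fun v ↦ h.connected v trivial⟩

/-- `G[S]` has a tree-decomposition all of whose bags satisfy `P` and with `X` as a bag. -/
def HasTreeDecompWith (G : SimpleGraph V) (P : Set V → Prop) (S X : Set V) : Prop :=
  ∃ (ι : Type) (T : SimpleGraph ι) (B : ι → Set V) (s : ι),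
    IsTreeDecompOn G S T B ∧ B s = X ∧ ∀ t, P (B t)

variable {P : Set V → Prop}

lemma HasTreeDecompWith.single {X : Set V} (hX : P X) : HasTreeDecompWith G P X X := by
  refine ⟨Unit, ⊥, fun _ ↦ X, (), ⟨.of_subsingleton, by simp, fun v hv ↦ ⟨(), hv⟩,
    fun v hv w hw _ ↦ ⟨(), hv, hw⟩, fun v hv ↦ ?_⟩, rfl, fun _ ↦ hX⟩
  have : Nonempty {t : Unit | v ∈ X} := ⟨(), hv⟩
  exact (IsTree.of_subsingleton).1

lemma SimpleGraph.Preconnected.induce_image {κ : Type} {T' : SimpleGraph κ} (f : T →g T')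
    {A : Set ι} (hA : (T.induce A).Preconnected) : (T'.induce (f '' A)).Preconnected := by
  rintro ⟨_, a, ha, rfl⟩ ⟨_, b, hb, rfl⟩
  exact (hA ⟨a, ha⟩ ⟨b, hb⟩).map (induceHom f (Set.mapsTo_image f A))

/-- Tree-decompositions can be joined along an edge between two of their nodes. -/
lemma HasTreeDecompWith.union {S₁ S₂ X₁ X₂ : Set V} (h₁ : HasTreeDecompWith G P S₁ X₁)
    (h₂ : HasTreeDecompWith G P S₂ X₂) (hX₁ : S₁ ∩ S₂ ⊆ X₁) (hX₂ : S₁ ∩ S₂ ⊆ X₂)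
    (hadj : ∀ v ∈ S₁, ∀ w ∈ S₂, G.Adj v w → v ∈ S₂ ∨ w ∈ S₁) :
    HasTreeDecompWith G P (S₁ ∪ S₂) X₁ := by
  obtain ⟨ι₁, T₁, B₁, s₁, h₁, rfl, hP₁⟩ := h₁
  obtain ⟨ι₂, T₂, B₂, s₂, h₂, rfl, hP₂⟩ := h₂
  refine ⟨ι₁ ⊕ ι₂, (T₁ ⊕g T₂) ⊔ edge (.inl s₁) (.inr s₂), Sum.elim B₁ B₂, .inl s₁,
    ⟨h₁.isTree.sum_sup_edge h₂.isTree s₁ s₂, ?_, ?_, ?_, ?_⟩, rfl, ?_⟩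
  · rintro (t | t)
    · exact (h₁.subset t).trans Set.subset_union_left
    · exact (h₂.subset t).trans Set.subset_union_right
  · rintro v (hv | hv)
    · exact (h₁.exists_mem v hv).imp' Sum.inl fun _ ↦ id
    · exact (h₂.exists_mem v hv).imp' Sum.inr fun _ ↦ id
  · have e₁ : ∀ v ∈ S₁, ∀ w ∈ S₁, G.Adj v w → ∃ t, v ∈ Sum.elim B₁ B₂ t ∧ w ∈ Sum.elim B₁ B₂ t :=
      fun v hv w hw h ↦ (h₁.exists_edge v hv w hw h).imp' Sum.inl fun _ ↦ id
    have e₂ : ∀ v ∈ S₂, ∀ w ∈ S₂, G.Adj v w → ∃ t, v ∈ Sum.elim B₁ B₂ t ∧ w ∈ Sum.elim B₁ B₂ t :=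
      fun v hv w hw h ↦ (h₂.exists_edge v hv w hw h).imp' Sum.inr fun _ ↦ id
    rintro v (hv | hv) w (hw | hw) h
    · exact e₁ v hv w hw h
    · exact (hadj v hv w hw h).elim (e₂ v · w hw h) (e₁ v hv w · h)
    · exact (hadj w hw v hv h.symm).elim (e₂ v hv w · h) (e₁ v · w hw h)
    · exact e₂ v hv w hw h
  · intro v hv
    let f₁ : T₁ →g (T₁ ⊕g T₂) ⊔ edge (.inl s₁) (.inr s₂) :=
      ⟨Sum.inl, fun h ↦ .inl (sum_adj_inl.2 h)⟩
    let f₂ : T₂ →g (T₁ ⊕g T₂) ⊔ edge (.inl s₁) (.inr s₂) :=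
      ⟨Sum.inr, fun h ↦ .inl (sum_adj_inr.2 h)⟩
    have hset : {t | v ∈ Sum.elim B₁ B₂ t} = f₁ '' {t | v ∈ B₁ t} ∪ f₂ '' {t | v ∈ B₂ t} := by
      ext (t | t) <;> simp [f₁, f₂]
    have hne₁ : v ∉ S₁ → {t | v ∈ B₁ t} = ∅ := fun h ↦
      Set.eq_empty_of_forall_notMem fun t ht ↦ h (h₁.subset t ht)
    have hne₂ : v ∉ S₂ → {t | v ∈ B₂ t} = ∅ := fun h ↦
      Set.eq_empty_of_forall_notMem fun t ht ↦ h (h₂.subset t ht)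
    rw [hset]
    by_cases hv₁ : v ∈ S₁
    · by_cases hv₂ : v ∈ S₂
      · exact connected_induce_union
          ((h₁.connected v hv₁).preconnected.induce_image f₁)
          ((h₂.connected v hv₂).preconnected.induce_image f₂)
          ⟨s₁, hX₁ ⟨hv₁, hv₂⟩, rfl⟩ ⟨s₂, hX₂ ⟨hv₁, hv₂⟩, rfl⟩
          (.inr (by simp [f₁, f₂, edge_adj]))
      · rw [hne₂ hv₂, Set.image_empty, Set.union_empty]
        have := (h₁.connected v hv₁).preconnected.induce_image f₁
        obtain ⟨t, ht⟩ := h₁.exists_mem v hv₁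
        have : Nonempty (f₁ '' {t | v ∈ B₁ t}) := ⟨⟨f₁ t, t, ht, rfl⟩⟩
        exact ⟨‹_›⟩
    · have hv₂ : v ∈ S₂ := hv.resolve_left hv₁
      rw [hne₁ hv₁, Set.image_empty, Set.empty_union]
      have := (h₂.connected v hv₂).preconnected.induce_image f₂
      obtain ⟨t, ht⟩ := h₂.exists_mem v hv₂
      have : Nonempty (f₂ '' {t | v ∈ B₂ t}) := ⟨⟨f₂ t, t, ht, rfl⟩⟩
      exact ⟨‹_›⟩
  · rintro (t | t)
    · exact hP₁ t
    · exact hP₂ t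

/-- The bag of `t` after restricting to `X ∪ C` and adding the vertices of `X` beyond `t`. -/
def pulledBag (T : SimpleGraph ι) (B : ι → Set V) (s : ι) (X C : Set V) (t : ι) : Set V :=
  B t ∩ (X ∪ C) ∪ X ∩ farSide T B s t

lemma IsTreeDecomp.isTreeDecompOn_pulledBag (h : IsTreeDecomp G T B) (s : ι) (X C : Set V) :
    IsTreeDecompOn G (X ∪ C) T (pulledBag T B s X C) where
  isTree := h.1
  subset t := Set.union_subset Set.inter_subset_right
    (Set.inter_subset_left.trans Set.subset_union_left)
  exists_mem v hv := (h.2.1 v).imp fun t ht ↦ .inl ⟨ht, hv⟩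
  exists_edge v hv w hw hvw := (h.2.2.1 hvw).imp fun t ht ↦ ⟨.inl ⟨ht.1, hv⟩, .inl ⟨ht.2, hw⟩⟩
  connected v hv := by
    classical
    by_cases hvX : v ∈ X
    · have hset : {t | v ∈ pulledBag T B s X C t} = {t | v ∈ farSide T B s t} := by
        ext t
        exact ⟨fun ht ↦ ht.elim (fun ht ↦ bag_subset_farSide s t ht.1) And.right,
          fun ht ↦ .inr ⟨hvX, ht⟩⟩
      rw [hset]
      obtain ⟨u, hu⟩ := h.2.1 v
      refine induce_connected_of_patches s ⟨u, hu, fun p ↦ p.start_mem_support⟩ ?_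
      rintro t ⟨u, hu, ht⟩
      obtain ⟨p, hp⟩ := (h.1.existsUnique_path s u).exists
      exact ⟨{x | x ∈ p.support}, fun x hx ↦ ⟨u, hu, h.1.2.onAllWalks_of_mem_support hp hx⟩,
        p.start_mem_support, ht p, p.connected_induce_support _ _⟩
    · have hset : {t | v ∈ pulledBag T B s X C t} = {t | v ∈ B t} := by
        ext t
        exact ⟨fun ht ↦ ht.elim And.left fun ht ↦ absurd ht.1 hvX, fun ht ↦ .inl ⟨ht, hv⟩⟩
      rw [hset]
      exact h.2.2.2 v

lemma pulledBag_root {s : ι} {X C : Set V} (h : IsTreeDecomp G T B) (hs : Disjoint (B s) C) :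
    pulledBag T B s X C s = X := by
  ext v
  refine ⟨fun hv ↦ hv.elim (fun hv ↦ ?_) And.left, fun hv ↦ .inr ⟨hv, ?_⟩⟩
  · exact hv.2.resolve_right (Set.disjoint_left.1 hs hv.1)
  · obtain ⟨u, hu⟩ := h.2.1 v
    exact ⟨u, hu, fun p ↦ p.start_mem_support⟩

/-- A connected set with vertices on both sides of a bag meets that bag. -/
lemma IsTreeDecomp.exists_mem_bag (h : IsTreeDecomp G T B) {A : Set V}
    (hA : (G.induce A).Preconnected) {s t : ι} {a b : V} (ha : a ∈ A) (hb : b ∈ A)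
    (hn : a ∈ nearSide T B s t) (hf : b ∈ farSide T B s t) : ∃ v ∈ A, v ∈ B t := by
  by_cases hbn : b ∈ nearSide T B s t
  · exact ⟨b, hb, h.mem_bag_of_mem_nearSide_of_mem_farSide hbn hf⟩
  · obtain ⟨a', ha', han, b', -, hbf, hadj⟩ := exists_adj_crossing hA ha hn hb hbn
    exact ⟨a', ha', h.mem_bag_of_mem_nearSide_of_mem_farSide han (h.mem_farSide_of_adj hadj hbf)⟩

/-- Trading the part of `X` beyond `t` for the part of the bag of `t` outside `X ∪ C` keeps
hitting the connected sets that `X` and the root bag hit. -/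
lemma IsTreeDecomp.exchange_hits (h : IsTreeDecomp G T B) {s : ι} (t : ι) {X C A : Set V}
    (hs : Disjoint (B s) C) (hCX : ∀ a ∈ C, ∀ b, G.Adj a b → b ∈ C ∪ X)
    (hA : (G.induce A).Preconnected) (hXA : (X ∩ A).Nonempty) (hsA : (B s ∩ A).Nonempty) :
    ((B t \ (X ∪ C) ∪ X ∩ nearSide T B s t) ∩ A).Nonempty := by
  by_contra hne
  have hX : ∀ v ∈ A, v ∈ X → v ∉ nearSide T B s t := fun v hv hvX hn ↦
    hne ⟨v, .inr ⟨hvX, hn⟩, hv⟩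
  have hB : ∀ v ∈ A, v ∈ B t → v ∈ X ∪ C := fun v hv hvB ↦ by
    by_contra hn
    exact hne ⟨v, .inl ⟨hvB, hn⟩, hv⟩
  obtain ⟨x, hx, hxA⟩ := hXA
  obtain ⟨a, ha, haA⟩ := hsA
  have han := root_bag_subset_nearSide (T := T) s t ha
  obtain ⟨a', ha'A, ⟨han', haX', haC'⟩, b', hb'A, hb', hadj⟩ := exists_adj_crossing
    (S := {v | v ∈ nearSide T B s t ∧ v ∉ X ∧ v ∉ C}) hA haA
    ⟨han, fun haX ↦ hX a haA haX han, Set.disjoint_left.1 hs ha⟩ hxA fun hx' ↦ hx'.2.1 hx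
  by_cases hbn : b' ∈ nearSide T B s t
  · have hbX : b' ∉ X := fun hbX ↦ hX b' hb'A hbX hbn
    have hbC : b' ∈ C := by
      by_contra hbC
      exact hb' ⟨hbn, hbX, hbC⟩
    exact (hCX b' hbC a' hadj.symm).elim haC' haX'
  · exact (hB a' ha'A (h.mem_bag_of_mem_nearSide_of_mem_farSide han'
      (h.mem_farSide_of_adj hadj hbn))).elim haX' haC'

lemma IsTreeDecomp.ncard_pulledBag_le [Finite V] (h : IsTreeDecomp G T B) {s t : ι}
    {X C : Set V} (hX : X.ncard ≤ (B t \ (X ∪ C) ∪ X ∩ nearSide T B s t).ncard) :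
    (pulledBag T B s X C t).ncard ≤ (B t).ncard := by
  have hsub : pulledBag T B s X C t ⊆ B t ∩ (X ∪ C) ∪ X \ nearSide T B s t := by
    rintro v (hv | ⟨hvX, hv⟩)
    · exact .inl hv
    · by_cases hn : v ∈ nearSide T B s t
      · exact .inl ⟨h.mem_bag_of_mem_nearSide_of_mem_farSide hn hv, .inl hvX⟩
      · exact .inr ⟨hvX, hn⟩
  have h1 := (Set.ncard_le_ncard hsub).trans (Set.ncard_union_le _ _)
  have h2 := hX.trans (Set.ncard_union_le _ _)
  have h3 := Set.ncard_inter_add_ncard_sdiff_eq_ncard X (nearSide T B s t)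
  have h4 := Set.ncard_inter_add_ncard_sdiff_eq_ncard (B t) (X ∪ C)
  omega

/-- A bag is admissible for `𝔅` if it has at most `k` vertices or does not hit `𝔅`. -/
def IsAdmissibleBag (k : ℕ) (𝔅 : Set (Set V)) (W : Set V) : Prop :=
  W.ncard ≤ k ∨ ∃ A ∈ 𝔅, Disjoint W A

lemma HasTreeDecompWith.pull [Finite V] {k : ℕ} {𝔅 : Set (Set V)} (h𝔅 : IsBramble G 𝔅)
    {X C Y : Set V} (hX : ∀ A ∈ 𝔅, (X ∩ A).Nonempty) (hXk : X.ncard ≤ k)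
    (hXmin : ∀ Z : Set V, (∀ A ∈ 𝔅, (Z ∩ A).Nonempty) → X.ncard ≤ Z.ncard)
    (hCX : ∀ a ∈ C, ∀ b, G.Adj a b → b ∈ C ∪ X)
    (h : HasTreeDecompWith G (IsAdmissibleBag k (insert C 𝔅)) Set.univ Y) :
    HasTreeDecompWith G (IsAdmissibleBag k 𝔅) Set.univ Y ∨
      HasTreeDecompWith G (IsAdmissibleBag k 𝔅) (X ∪ C) X := by
  obtain ⟨ι, T, B, r, hT, hr, hadm⟩ := h
  by_cases hall : ∀ t, IsAdmissibleBag k 𝔅 (B t)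
  · exact .inl ⟨ι, T, B, r, hT, hr, hall⟩
  right
  obtain ⟨s, hs⟩ := not_forall.1 hall
  have hsk : ¬ (B s).ncard ≤ k := fun h ↦ hs (.inl h)
  have hs𝔅 : ∀ A ∈ 𝔅, (B s ∩ A).Nonempty := fun A hA ↦
    Set.not_disjoint_iff_nonempty_inter.1 fun hd ↦ hs (.inr ⟨A, hA, hd⟩)
  have hsC : Disjoint (B s) C := by
    obtain ⟨A, rfl | hA, hd⟩ := (hadm s).resolve_left hsk
    · exact hd
    · exact absurd (.inr ⟨A, hA, hd⟩) hs
  replace hT := hT.isTreeDecomp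
  refine ⟨ι, T, pulledBag T B s X C, s, hT.isTreeDecompOn_pulledBag s X C,
    pulledBag_root hT hsC, fun t ↦ ?_⟩
  by_contra hW
  have hWk : ¬ (pulledBag T B s X C t).ncard ≤ k := fun h ↦ hW (.inl h)
  have hle : (pulledBag T B s X C t).ncard ≤ (B t).ncard :=
    hT.ncard_pulledBag_le (hXmin _ fun A hA ↦
      hT.exchange_hits t hsC hCX (h𝔅 A hA).2.1.preconnected (hX A hA) (hs𝔅 A hA))
  have hBC : ¬ Disjoint (B t) C := by
    intro hd
    refine hWk ((Set.ncard_le_ncard fun v hv ↦ ?_).trans hXk)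
    exact hv.elim (fun hv ↦ hv.2.resolve_right (Set.disjoint_left.1 hd hv.1)) And.left
  obtain ⟨A, rfl | hA, hd⟩ := (hadm t).resolve_left (by omega)
  · exact hBC hd
  · refine hW (.inr ⟨A, hA, Set.disjoint_left.2 ?_⟩)
    rintro v (hv | hv) hvA
    · exact Set.disjoint_left.1 hd hv.1 hvA
    · obtain ⟨a, has, haA⟩ := hs𝔅 A hA
      obtain ⟨w, hwA, hw⟩ := hT.exists_mem_bag (h𝔅 A hA).2.1.preconnected haA hvA
        (root_bag_subset_nearSide s t has) hv.2
      exact Set.disjoint_left.1 hd hw hwA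

lemma SimpleGraph.exists_connected_avoiding {X : Set V} {v : V} (hv : v ∉ X) :
    ∃ C : Set V, v ∈ C ∧ Disjoint C X ∧ (G.induce C).Connected ∧
      ∀ a ∈ C, ∀ b, G.Adj a b → b ∈ C ∪ X := by
  classical
  refine ⟨{w | ∃ p : G.Walk v w, ∀ x ∈ p.support, x ∉ X}, ⟨.nil, by simpa⟩,
    Set.disjoint_left.2 ?_, ?_, ?_⟩
  · rintro w ⟨p, hp⟩
    exact hp w p.end_mem_support
  · refine induce_connected_of_patches v ⟨.nil, by simpa⟩ ?_
    rintro w ⟨p, hp⟩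
    exact ⟨{x | x ∈ p.support},
      fun x hx ↦ ⟨p.takeUntil x hx, fun y hy ↦ hp y (p.support_takeUntil_subset_support hx hy)⟩,
      p.start_mem_support, p.end_mem_support, p.connected_induce_support _ _⟩
  · rintro a ⟨p, hp⟩ b hab
    by_cases hb : b ∈ X
    · exact .inr hb
    · refine .inl ⟨p.concat hab, fun x hx ↦ ?_⟩
      rw [Walk.support_concat, List.mem_append, List.mem_singleton] at hx
      rcases hx with hx | rfl
      · exact hp x hx
      · exact hb

/-- One component `C` of `G - X` can be decomposed together with `X`. -/
lemma IsBramble.hasTreeDecompWith_component [Finite V] {k : ℕ} {𝔅 : Set (Set V)}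
    (h𝔅 : IsBramble G 𝔅) {X C : Set V} (hX : ∀ A ∈ 𝔅, (X ∩ A).Nonempty) (hXk : X.ncard ≤ k)
    (hXmin : ∀ Z : Set V, (∀ A ∈ 𝔅, (Z ∩ A).Nonempty) → X.ncard ≤ Z.ncard)
    (hne : C.Nonempty) (hdisj : Disjoint C X) (hC : (G.induce C).Connected)
    (hCX : ∀ a ∈ C, ∀ b, G.Adj a b → b ∈ C ∪ X)
    (ih : ∀ 𝔅' > 𝔅, IsBramble G 𝔅' →
      ∃ Y, HasTreeDecompWith G (IsAdmissibleBag k 𝔅') Set.univ Y) :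
    (∃ Y, HasTreeDecompWith G (IsAdmissibleBag k 𝔅) Set.univ Y) ∨
      HasTreeDecompWith G (IsAdmissibleBag k 𝔅) (X ∪ C) X := by
  by_cases htouch : ∀ A ∈ 𝔅, (C ∩ A).Nonempty ∨ ∃ c ∈ C, ∃ a ∈ A, G.Adj c a
  · have hC𝔅 : C ∉ 𝔅 := fun h ↦
      (hX C h).ne_empty (Set.disjoint_iff_inter_eq_empty.1 hdisj.symm)
    have hb : IsBramble G (insert C 𝔅) := by
      rintro A (rfl | hA)
      · refine ⟨hne, hC, ?_⟩
        rintro A' (rfl | hA')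
        · exact .inl (by simpa using hne)
        · exact htouch A' hA'
      · refine ⟨(h𝔅 A hA).1, (h𝔅 A hA).2.1, ?_⟩
        rintro A' (rfl | hA')
        · rcases htouch A hA with h | ⟨c, hc, a, ha, hca⟩
          · exact .inl (by rwa [Set.inter_comm])
          · exact .inr ⟨a, ha, c, hc, hca.symm⟩
        · exact (h𝔅 A hA).2.2 A' hA'
    obtain ⟨Y, hY⟩ := ih _ (Set.ssubset_insert hC𝔅) hb
    exact (hY.pull h𝔅 hX hXk hXmin hCX).imp_left fun h ↦ ⟨Y, h⟩
  · right
    push Not at htouch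
    obtain ⟨A, hA, hCA, hadj⟩ := htouch
    let N : Set V := {x ∈ X | ∃ c ∈ C, G.Adj c x}
    have hY : IsAdmissibleBag k 𝔅 (C ∪ N) := by
      refine .inr ⟨A, hA, Set.disjoint_left.2 ?_⟩
      rintro v (hv | ⟨-, c, hc, hcv⟩) hvA
      · exact Set.eq_empty_iff_forall_notMem.1 hCA v ⟨hv, hvA⟩
      · exact hadj c hc v hvA hcv
    have hS : X ∪ C = X ∪ (C ∪ N) := by
      ext v
      simp only [Set.mem_union, N, Set.mem_ofPred_eq]
      tauto
    rw [hS]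
    refine (HasTreeDecompWith.single (.inl hXk)).union (.single hY) Set.inter_subset_left
      Set.inter_subset_right ?_
    rintro v hv w (hw | hw) hvw
    · exact .inl (.inr ⟨hv, w, hw, hvw.symm⟩)
    · exact .inr hw.1

/-- If every bramble has a hitting set of size at most `k`, then every bramble has a
tree-decomposition of `G` with admissible bags. -/
lemma IsBramble.exists_hasTreeDecompWith [Finite V] {k : ℕ}
    (hk : ∀ 𝔅, IsBramble G 𝔅 → ∃ X : Set V, (∀ A ∈ 𝔅, (X ∩ A).Nonempty) ∧ X.ncard ≤ k)
    (𝔅 : Set (Set V)) (h𝔅 : IsBramble G 𝔅) :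
    ∃ Y, HasTreeDecompWith G (IsAdmissibleBag k 𝔅) Set.univ Y := by
  induction 𝔅 using WellFoundedGT.induction with
  | ind 𝔅 ih =>
  obtain ⟨X, hX, hXmin⟩ := Set.exists_min_image
    {X : Set V | ∀ A ∈ 𝔅, (X ∩ A).Nonempty} Set.ncard (Set.toFinite _)
    ((hk 𝔅 h𝔅).imp fun _ ↦ And.left)
  have hXk : X.ncard ≤ k := by
    obtain ⟨Y, hY, hYk⟩ := hk 𝔅 h𝔅
    exact (hXmin Y hY).trans hYk
  by_contra hno
  obtain ⟨D, ⟨hDX, hD⟩, hDmax⟩ := Set.Finite.exists_maximal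
    (s := {D : Set V | (∀ a ∈ D, ∀ b, G.Adj a b → b ∈ D ∪ X) ∧
      HasTreeDecompWith G (IsAdmissibleBag k 𝔅) (X ∪ D) X}) (Set.toFinite _)
    ⟨∅, by simp, by simpa using HasTreeDecompWith.single (.inl hXk)⟩
  by_cases huniv : X ∪ D = Set.univ
  · exact hno ⟨X, huniv ▸ hD⟩
  obtain ⟨v, hv⟩ := (Set.ne_univ_iff_exists_notMem _).1 huniv
  rw [Set.mem_union, not_or] at hv
  obtain ⟨C, hvC, hdisj, hC, hCX⟩ := exists_connected_avoiding (G := G) hv.1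
  have hXC := (h𝔅.hasTreeDecompWith_component hX hXk hXmin ⟨v, hvC⟩ hdisj hC hCX
    ih).resolve_left hno
  have hDC : ∀ w ∈ D, w ∉ C := by
    intro w hwD hwC
    obtain ⟨a, -, haD, b, hbC, hbD, hab⟩ := exists_adj_crossing hC.preconnected hwC hwD hvC hv.2
    exact (hDX a haD b hab).elim hbD (Set.disjoint_left.1 hdisj hbC)
  have hsub : (X ∪ D) ∩ (X ∪ C) ⊆ X := by
    rintro w ⟨hw | hw, hw' | hw'⟩
    · exact hw
    · exact hw
    · exact hw'
    · exact absurd hw' (hDC w hw)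
  refine hv.2 (hDmax (y := D ∪ C) ⟨?_, ?_⟩ Set.subset_union_left (.inr hvC))
  · rintro a (ha | ha) b hab
    · exact (hDX a ha b hab).imp_left .inl
    · exact (hCX a ha b hab).imp_left .inr
  · rw [Set.union_union_distrib_left]
    refine hD.union hXC hsub hsub ?_
    rintro a (ha | ha) b hb hab
    · exact .inl (.inl ha)
    · exact .inr ((hDX a ha b hab).elim .inr .inl)

end TreeDecomp

section BrambleNumber

variable {V : Type} {G : SimpleGraph V} {𝔅 : Set (Set V)}

lemma brambleOrder_le {X : Set V} (hX : ∀ A ∈ 𝔅, (X ∩ A).Nonempty) :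
    brambleOrder G 𝔅 ≤ X.ncard :=
  Nat.sInf_le ⟨X, hX, rfl⟩

lemma IsBramble.exists_hitting_ncard_eq (h𝔅 : IsBramble G 𝔅) :
    ∃ X : Set V, (∀ A ∈ 𝔅, (X ∩ A).Nonempty) ∧ X.ncard = brambleOrder G 𝔅 :=
  Nat.sInf_mem (s := {n | ∃ X : Set V, (∀ A ∈ 𝔅, (X ∩ A).Nonempty) ∧ X.ncard = n})
    ⟨_, Set.univ, fun A hA ↦ by simpa using (h𝔅 A hA).1, rfl⟩

lemma IsBramble.brambleOrder_le_brambleNumber [Finite V] (h𝔅 : IsBramble G 𝔅) :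
    brambleOrder G 𝔅 ≤ brambleNumber G := by
  refine le_csSup ⟨(Set.univ : Set V).ncard, ?_⟩ ⟨𝔅, h𝔅, rfl⟩
  rintro _ ⟨𝔅', h, rfl⟩
  exact brambleOrder_le fun A hA ↦ by simpa using (h A hA).1

/-- There is a tree-decomposition whose bags have size at most the bramble number. -/
lemma exists_isTreeDecomp_ncard_le_brambleNumber [Finite V] (G : SimpleGraph V) :
    ∃ (ι : Type) (T : SimpleGraph ι) (B : ι → Set V),
      IsTreeDecomp G T B ∧ ∀ t, (B t).ncard ≤ brambleNumber G := by
  obtain ⟨_, ι, T, B, _, hT, -, hB⟩ := IsBramble.exists_hasTreeDecompWith (G := G)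
    (k := brambleNumber G) (fun 𝔅 h𝔅 ↦ by
      obtain ⟨X, hX, hXc⟩ := h𝔅.exists_hitting_ncard_eq
      exact ⟨X, hX, hXc.trans_le h𝔅.brambleOrder_le_brambleNumber⟩) ∅ (by simp [IsBramble])
  exact ⟨ι, T, B, hT.isTreeDecomp, fun t ↦ (hB t).resolve_right (by simp)⟩

end BrambleNumber

/-- Treewidth Duality Theorem (Seymour–Thomas): `tw(G) + 1 = bn(G)`. -/
theorem stmt10 {V : Type} [Fintype V] [Nonempty V] (G : SimpleGraph V) :
    treewidth G + 1 = brambleNumber G := by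
  obtain ⟨ι, T, B, hT, hB⟩ := exists_isTreeDecomp_ncard_le_brambleNumber G
  have hpos : 1 ≤ brambleNumber G := by
    obtain ⟨v⟩ := ‹Nonempty V›
    obtain ⟨t, ht⟩ := hT.2.1 v
    exact ((Set.ncard_pos (Set.toFinite _)).2 ⟨v, ht⟩).trans_le (hB t)
  have hmem : brambleNumber G - 1 ∈ {k | HasTreeDecompOfWidth G k} :=
    ⟨ι, T, B, hT, fun t ↦ by have := hB t; omega⟩
  refine le_antisymm ?_ (csSup_le ⟨_, ∅, by simp [IsBramble], rfl⟩ ?_)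
  · have : treewidth G ≤ brambleNumber G - 1 := Nat.sInf_le hmem
    omega
  · rintro _ ⟨𝔅, h𝔅, rfl⟩
    obtain ⟨ι, T, B, hT, hB⟩ : HasTreeDecompOfWidth G (treewidth G) := Nat.sInf_mem ⟨_, hmem⟩
    obtain ⟨t, ht⟩ := hT.exists_bag_hitting h𝔅
    exact (brambleOrder_le ht).trans (hB t)
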